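/- arXiv:1607.02087 — 4 statements merged into one kernel-verified Lean document; each statement's English description precedes it below -/
import Mathlib

section
/- For every integer k ≥ 1 and every minimiser (a₁*, a₂*, a₃*) for λ_k, one has a₁* ≥ (8(1/2 + √3))^{-1} = 1/(4 + 8√3). -/
/-- The Dirichlet eigenvalue counting function of the cuboid `(0,a₁)×(0,a₂)×(0,a₃)`:
the number of triples `(i₁,i₂,i₃) ∈ ℤ³` with `i₁,i₂,i₃ ≥ 1` and
`π²(i₁²/a₁² + i₂²/a₂² + i₃²/a₃²) ≤ lam`. -/
noncomputable def cuboidCount (a₁ a₂ a₃ lam : ℝ) : ℕ :=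
  Nat.card {p : ℤ × ℤ × ℤ //
    1 ≤ p.1 ∧ 1 ≤ p.2.1 ∧ 1 ≤ p.2.2 ∧
    Real.pi ^ 2 * ((p.1 : ℝ) ^ 2 / a₁ ^ 2 + (p.2.1 : ℝ) ^ 2 / a₂ ^ 2
      + (p.2.2 : ℝ) ^ 2 / a₃ ^ 2) ≤ lam}

/-- `cuboidEig a₁ a₂ a₃ k` is the `k`-th smallest Dirichlet eigenvalue (counted with
multiplicity) of the cuboid `(0,a₁)×(0,a₂)×(0,a₃)`, expressed as the least `lam` whose
eigenvalue count is at least `k`. -/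
noncomputable def cuboidEig (a₁ a₂ a₃ : ℝ) (k : ℕ) : ℝ :=
  sInf {lam : ℝ | k ≤ cuboidCount a₁ a₂ a₃ lam}

/-- `(a₁,a₂,a₃)` is a minimiser for `λ_k` among cuboids of unit measure. -/
noncomputable def IsMinimiser (k : ℕ) (a₁ a₂ a₃ : ℝ) : Prop :=
  0 < a₁ ∧ a₁ ≤ a₂ ∧ a₂ ≤ a₃ ∧ a₁ * a₂ * a₃ = 1 ∧
    ∀ b₁ b₂ b₃ : ℝ, 0 < b₁ → b₁ ≤ b₂ → b₂ ≤ b₃ → b₁ * b₂ * b₃ = 1 →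
      cuboidEig a₁ a₂ a₃ k ≤ cuboidEig b₁ b₂ b₃ k

open MeasureTheory

theorem cub_sum_bound (n : ℕ) (t : ℝ) (hn : 1 ≤ n) (h1 : (n:ℝ) ≤ t) (h2 : t < n + 1) :
    (n:ℝ) * t^2 - (n:ℝ) * (n+1) * (2*n+1) / 6 ≤ 2/3 * t^3 - t^2/4 := by
  obtain ⟨u, rfl⟩ : ∃ u, t = n + u := ⟨t - n, by ring⟩
  have hn' : (1:ℝ) ≤ n := by exact_mod_cast hn
  have hu0 : 0 ≤ u := by linarith
  have hu1 : u ≤ 1 := by linarith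
  have a1 : 0 ≤ (n:ℝ) * (u^2 - u/2 + 1/6) := by
    apply mul_nonneg (by linarith); nlinarith [sq_nonneg (u - 1/4)]
  have a2 : u^2 ≤ (n:ℝ)^2 := by nlinarith
  have a3 : 0 ≤ u^3 := by positivity
  nlinarith

theorem cub_sum_eq (n : ℕ) (x c : ℝ) :
    ∑ i ∈ Finset.Icc (1:ℤ) n, (x - (i:ℝ)^2 * c) = n * x - n * (n+1) * (2*n+1) / 6 * c := by
  induction n with
  | zero => simp
  | succ m ih =>
    have : Finset.Icc (1:ℤ) ((m+1 : ℕ):ℤ) = insert ((m:ℤ)+1) (Finset.Icc (1:ℤ) m) := by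
      ext j; simp only [Finset.mem_insert, Finset.mem_Icc]; push_cast; omega
    rw [this, Finset.sum_insert (by simp), ih]
    push_cast; ring

/-- quarter disc -/
def cubQ : Set (ℝ × ℝ) := {p | 0 < p.1 ∧ 0 < p.2 ∧ p.1^2 + p.2^2 ≤ 1}

/-- area of the quarter disc -/
noncomputable def cubV : ℝ := (volume cubQ).toReal

theorem cubQ_meas : MeasurableSet cubQ := by
  unfold cubQ
  rw [Set.ofPred_and]
  refine MeasurableSet.inter (measurableSet_lt (by fun_prop) (by fun_prop)) ?_
  rw [Set.ofPred_and]
  refine MeasurableSet.inter (measurableSet_lt (by fun_prop) (by fun_prop)) ?_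
  exact measurableSet_le (by fun_prop) (by fun_prop)

theorem cubQ_ne_top : volume cubQ ≠ ⊤ := by
  have : cubQ ⊆ Set.Ioc 0 1 ×ˢ Set.Ioc 0 1 := by
    rintro ⟨x, y⟩ ⟨h1, h2, h3⟩
    simp only at h1 h2 h3
    simp only [Set.mem_prod, Set.mem_Ioc]
    refine ⟨⟨h1, ?_⟩, h2, ?_⟩ <;> nlinarith
  refine ne_top_of_le_ne_top ?_ (measure_mono this)
  rw [Measure.volume_eq_prod, Measure.prod_prod]
  simp

theorem cubV_pos : 0 < cubV := by
  have : Set.Ioc (0:ℝ) (1/2) ×ˢ Set.Ioc (0:ℝ) (1/2) ⊆ cubQ := by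
    rintro ⟨x, y⟩ ⟨⟨h1, h2⟩, h3, h4⟩
    simp only at h1 h2 h3 h4
    refine ⟨h1, h3, ?_⟩
    simp only
    nlinarith
  have h := measure_mono (μ := volume) this
  refine ENNReal.toReal_pos ?_ cubQ_ne_top
  intro h0
  rw [h0, Measure.volume_eq_prod, Measure.prod_prod] at h
  simp at h

theorem cubV_ofReal : volume cubQ = ENNReal.ofReal cubV :=
  (ENNReal.ofReal_toReal cubQ_ne_top).symm

/-- quarter ellipse -/
theorem cub_ell (A B : ℝ) (hA : 0 < A) (hB : 0 < B) :
    volume {p : ℝ × ℝ | 0 < p.1 ∧ 0 < p.2 ∧ p.1^2 / A^2 + p.2^2 / B^2 ≤ 1}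
      = ENNReal.ofReal (A * B * cubV) := by
  have e : {p : ℝ × ℝ | 0 < p.1 ∧ 0 < p.2 ∧ p.1^2 / A^2 + p.2^2 / B^2 ≤ 1}
      = (Prod.map (fun x => A⁻¹ * x) (fun y => B⁻¹ * y)) ⁻¹' cubQ := by
    ext ⟨x, y⟩
    simp only [cubQ, Set.mem_ofPred_eq, Set.mem_preimage, Prod.map]
    rw [mul_pos_iff_of_pos_left (by positivity), mul_pos_iff_of_pos_left (by positivity)]
    have : (A⁻¹ * x)^2 + (B⁻¹ * y)^2 = x^2 / A^2 + y^2/B^2 := by field_simp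
    rw [this]
  rw [e, ← Measure.map_apply (by fun_prop) cubQ_meas, Measure.volume_eq_prod,
    ← Measure.map_prod_map _ _ (by fun_prop) (by fun_prop),
    Real.map_volume_mul_left (by positivity), Real.map_volume_mul_left (by positivity),
    Measure.prod_smul_left, Measure.prod_smul_right, Measure.smul_apply, Measure.smul_apply,
    ← Measure.volume_eq_prod, cubV_ofReal, smul_eq_mul, smul_eq_mul,
    ← ENNReal.ofReal_mul (by positivity), ← ENNReal.ofReal_mul (by positivity)]
  rw [inv_inv, inv_inv, abs_of_pos hA, abs_of_pos hB, mul_assoc]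

theorem cub_ell' (A B s : ℝ) (hA : 0 < A) (hB : 0 < B) (hs : 0 ≤ s) :
    volume {p : ℝ × ℝ | 0 < p.1 ∧ 0 < p.2 ∧ p.1^2 / A^2 + p.2^2 / B^2 ≤ s}
      = ENNReal.ofReal (A * B * s * cubV) := by
  rcases hs.eq_or_lt with rfl | hs
  · have : {p : ℝ × ℝ | 0 < p.1 ∧ 0 < p.2 ∧ p.1^2 / A^2 + p.2^2 / B^2 ≤ 0} = ∅ := by
      ext ⟨x, y⟩
      simp only [Set.mem_ofPred_eq, Set.mem_empty_iff_false, iff_false]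
      rintro ⟨h1, h2, h3⟩
      have : 0 < x^2/A^2 + y^2/B^2 := by positivity
      linarith
    rw [this]; simp
  · have h := cub_ell (A * √s) (B * √s) (by positivity) (by positivity)
    have e : A * √s * (B * √s) * cubV = A * B * s * cubV := by
      linear_combination (A * B * cubV) * Real.mul_self_sqrt hs.le
    rw [← e, ← h]
    congr 1
    ext ⟨x, y⟩
    simp only [Set.mem_ofPred_eq]
    rw [mul_pow, mul_pow, Real.sq_sqrt hs.le]
    have : x^2/(A^2*s) + y^2/(B^2*s) = (x^2/A^2 + y^2/B^2)/s := by field_simp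
    rw [this, div_le_one hs]

/-- planar counting bound -/
theorem cub_card_le (G : Finset (ℤ × ℤ)) (A B s : ℝ) (hA : 0 < A) (hB : 0 < B) (hs : 0 ≤ s)
    (h : ∀ p ∈ G, 1 ≤ p.1 ∧ 1 ≤ p.2 ∧ (p.1:ℝ)^2 / A^2 + (p.2:ℝ)^2 / B^2 ≤ s) :
    (G.card : ℝ) ≤ A * B * s * cubV := by
  set sq : ℤ × ℤ → Set (ℝ × ℝ) := fun p => Set.Ioc ((p.1:ℝ)-1) p.1 ×ˢ Set.Ioc ((p.2:ℝ)-1) p.2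
    with hsq
  have hd : (G : Set (ℤ × ℤ)).PairwiseDisjoint sq := by
    rintro ⟨i, j⟩ _ ⟨i', j'⟩ _ hne
    refine Set.disjoint_left.2 ?_
    rintro ⟨x, y⟩ ⟨⟨h1, h2⟩, h3, h4⟩ ⟨⟨h5, h6⟩, h7, h8⟩
    simp only at h1 h2 h3 h4 h5 h6 h7 h8
    apply hne
    have e1 : i < i' + 1 := by
      have : (i:ℝ) < i' + 1 := by linarith
      exact_mod_cast this
    have e2 : i' < i + 1 := by
      have : (i':ℝ) < i + 1 := by linarith
      exact_mod_cast this
    have e3 : j < j' + 1 := by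
      have : (j:ℝ) < j' + 1 := by linarith
      exact_mod_cast this
    have e4 : j' < j + 1 := by
      have : (j':ℝ) < j + 1 := by linarith
      exact_mod_cast this
    ext <;> simp only <;> omega
  have hm : volume (⋃ p ∈ G, sq p) = (G.card : ENNReal) := by
    rw [measure_biUnion_finset hd (fun p _ => measurableSet_Ioc.prod measurableSet_Ioc)]
    rw [Finset.sum_congr rfl (g := fun _ => (1:ENNReal))]
    · simp
    · intro p _
      rw [hsq, Measure.volume_eq_prod, Measure.prod_prod]
      simp
  have hsub : (⋃ p ∈ G, sq p) ⊆
      {p : ℝ × ℝ | 0 < p.1 ∧ 0 < p.2 ∧ p.1^2 / A^2 + p.2^2 / B^2 ≤ s} := by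
    refine Set.iUnion₂_subset ?_
    rintro ⟨i, j⟩ hp ⟨x, y⟩ ⟨⟨h1, h2⟩, h3, h4⟩
    simp only at h1 h2 h3 h4
    obtain ⟨g1, g2, g3⟩ := h _ hp
    simp only at g1 g2 g3
    have g1' : (1:ℝ) ≤ i := by exact_mod_cast g1
    have g2' : (1:ℝ) ≤ j := by exact_mod_cast g2
    have hx : 0 < x := by linarith
    have hy : 0 < y := by linarith
    refine ⟨hx, hy, le_trans ?_ g3⟩
    simp only
    gcongr
  have := measure_mono (μ := volume) hsub
  rw [hm, cub_ell' A B s hA hB hs] at this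
  have hV := cubV_pos
  rw [← ENNReal.ofReal_natCast, ENNReal.ofReal_le_ofReal_iff (by positivity)] at this
  exact this

/-- cuboidCount as the cardinality of an explicit finset -/
theorem cub_finset (a b c lam : ℝ) (ha : 0 < a) (hb : 0 < b) (hc : 0 < c) :
    ∃ F : Finset (ℤ × ℤ × ℤ), (∀ p, p ∈ F ↔ (1 ≤ p.1 ∧ 1 ≤ p.2.1 ∧ 1 ≤ p.2.2 ∧
      Real.pi ^ 2 * ((p.1 : ℝ) ^ 2 / a ^ 2 + (p.2.1 : ℝ) ^ 2 / b ^ 2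
      + (p.2.2 : ℝ) ^ 2 / c ^ 2) ≤ lam)) ∧ cuboidCount a b c lam = F.card := by
  classical
  have key : ∀ (x u v d : ℝ), 1 ≤ x → 0 ≤ u → 0 ≤ v → 0 < d →
      Real.pi ^ 2 * (x^2/d^2 + u + v) ≤ lam → x ≤ lam / Real.pi^2 * d^2 := by
    intro x u v d hx hu hv hd h
    have hp : 0 < Real.pi^2 := by positivity
    have h1 : x^2/d^2 + u + v ≤ lam / Real.pi^2 := by
      rw [le_div_iff₀ hp]; linarith
    have h2 : x^2/d^2 ≤ lam / Real.pi^2 := by linarith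
    rw [div_le_iff₀ (by positivity)] at h2
    nlinarith
  let B : Finset (ℤ × ℤ × ℤ) := Finset.Icc 1 ⌊lam / Real.pi^2 * a^2⌋ ×ˢ
    (Finset.Icc 1 ⌊lam / Real.pi^2 * b^2⌋ ×ˢ Finset.Icc 1 ⌊lam / Real.pi^2 * c^2⌋)
  have hF : ∀ p : ℤ × ℤ × ℤ, p ∈ B.filter (fun p => 1 ≤ p.1 ∧ 1 ≤ p.2.1 ∧ 1 ≤ p.2.2 ∧
      Real.pi ^ 2 * ((p.1 : ℝ) ^ 2 / a ^ 2 + (p.2.1 : ℝ) ^ 2 / b ^ 2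
      + (p.2.2 : ℝ) ^ 2 / c ^ 2) ≤ lam) ↔ (1 ≤ p.1 ∧ 1 ≤ p.2.1 ∧ 1 ≤ p.2.2 ∧
      Real.pi ^ 2 * ((p.1 : ℝ) ^ 2 / a ^ 2 + (p.2.1 : ℝ) ^ 2 / b ^ 2
      + (p.2.2 : ℝ) ^ 2 / c ^ 2) ≤ lam) := by
    intro p
    rw [Finset.mem_filter, and_iff_right_iff_imp]
    rintro ⟨h1, h2, h3, h4⟩
    have h1' : (1:ℝ) ≤ p.1 := by exact_mod_cast h1
    have h2' : (1:ℝ) ≤ p.2.1 := by exact_mod_cast h2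
    have h3' : (1:ℝ) ≤ p.2.2 := by exact_mod_cast h3
    simp only [B, Finset.mem_product, Finset.mem_Icc, Int.le_floor]
    refine ⟨⟨h1, ?_⟩, ⟨h2, ?_⟩, h3, ?_⟩
    · exact key _ ((p.2.1:ℝ)^2/b^2) ((p.2.2:ℝ)^2/c^2) _ h1' (by positivity) (by positivity) ha h4
    · refine key _ ((p.1:ℝ)^2/a^2) ((p.2.2:ℝ)^2/c^2) _ h2' (by positivity) (by positivity) hb ?_
      linarith
    · refine key _ ((p.1:ℝ)^2/a^2) ((p.2.1:ℝ)^2/b^2) _ h3' (by positivity) (by positivity) hc ?_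
      linarith
  exact ⟨_, hF, Nat.subtype_card _ hF⟩

theorem cub_mono (a b c l m : ℝ) (ha : 0 < a) (hb : 0 < b) (hc : 0 < c) (h : l ≤ m) :
    cuboidCount a b c l ≤ cuboidCount a b c m := by
  obtain ⟨F, hF, eF⟩ := cub_finset a b c l ha hb hc
  obtain ⟨G, hG, eG⟩ := cub_finset a b c m ha hb hc
  rw [eF, eG]
  apply Finset.card_le_card
  intro p hp
  rw [hF] at hp
  rw [hG]
  exact ⟨hp.1, hp.2.1, hp.2.2.1, hp.2.2.2.trans h⟩

/-- a positive count forces a large eigenvalue -/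
theorem cub_pos_count (a b c l : ℝ) (ha : 0 < a) (hb : 0 < b) (hc : 0 < c)
    (h : 1 ≤ cuboidCount a b c l) : Real.pi^2 / a^2 ≤ l := by
  obtain ⟨F, hF, eF⟩ := cub_finset a b c l ha hb hc
  rw [eF] at h
  obtain ⟨p, hp⟩ := Finset.card_pos.1 h
  obtain ⟨h1, h2, h3, h4⟩ := (hF p).1 hp
  have h1' : (1:ℝ) ≤ p.1 := by exact_mod_cast h1
  refine le_trans ?_ h4
  rw [div_eq_mul_one_div]
  apply mul_le_mul_of_nonneg_left _ (by positivity)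
  have e1 : 1 / a^2 ≤ (p.1:ℝ)^2/a^2 := by
    apply div_le_div_of_nonneg_right _ (by positivity)
    nlinarith
  have e2 : 0 ≤ (p.2.1:ℝ)^2/b^2 := by positivity
  have e3 : 0 ≤ (p.2.2:ℝ)^2/c^2 := by positivity
  linarith

theorem cub_nonempty (a b c : ℝ) (ha : 0 < a) (hb : 0 < b) (hc : 0 < c) (k : ℕ) :
    ∃ l, k ≤ cuboidCount a b c l := by
  refine ⟨Real.pi ^ 2 * ((k : ℝ) ^ 2 / a ^ 2 + 1 / b ^ 2 + 1 / c ^ 2), ?_⟩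
  obtain ⟨F, hF, eF⟩ := cub_finset a b c
    (Real.pi ^ 2 * ((k : ℝ) ^ 2 / a ^ 2 + 1 / b ^ 2 + 1 / c ^ 2)) ha hb hc
  rw [eF]
  have : ((Finset.range k).image (fun n : ℕ => (((n:ℤ)+1, 1, 1) : ℤ × ℤ × ℤ))) ⊆ F := by
    intro p hp
    rw [Finset.mem_image] at hp
    obtain ⟨n, hn, rfl⟩ := hp
    rw [Finset.mem_range] at hn
    rw [hF]
    refine ⟨by simp only; omega, le_refl _, le_refl _, ?_⟩
    have : (n:ℝ) + 1 ≤ k := by exact_mod_cast hn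
    push_cast
    rw [one_pow]
    gcongr
  have h := Finset.card_le_card this
  rwa [Finset.card_image_of_injective _ (by intro x y h; simpa using h), Finset.card_range] at h

/-- upper bound for the counting function -/
theorem cub_upper (a b c r : ℝ) (ha : 0 < a) (hb : 0 < b) (hc : 0 < c) (habc : a * b * c = 1)
    (hr : 0 < r) (har : 1 ≤ a * r) :
    (cuboidCount a b c (Real.pi^2 * r^2) : ℝ) ≤ cubV * (2/3 * r^3 - r^2 / (4*a)) := by
  classical
  obtain ⟨F, hF, eF⟩ := cub_finset a b c (Real.pi^2 * r^2) ha hb hc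
  have hF' : ∀ p ∈ F, (1 ≤ p.1 ∧ 1 ≤ p.2.1 ∧ 1 ≤ p.2.2 ∧
      (p.1 : ℝ) ^ 2 / a ^ 2 + (p.2.1 : ℝ) ^ 2 / b ^ 2 + (p.2.2 : ℝ) ^ 2 / c ^ 2 ≤ r^2) := by
    intro p hp
    obtain ⟨h1, h2, h3, h4⟩ := (hF p).1 hp
    exact ⟨h1, h2, h3, le_of_mul_le_mul_left h4 (by positivity)⟩
  set n := ⌊a * r⌋₊ with hn
  have hn1 : 1 ≤ n := by rw [hn, Nat.one_le_floor_iff]; exact har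
  have hnle : (n:ℝ) ≤ a * r := Nat.floor_le (by positivity)
  have hnlt : a * r < n + 1 := Nat.lt_floor_add_one _
  have hmaps : (F : Set (ℤ × ℤ × ℤ)).MapsTo Prod.fst (Finset.Icc (1:ℤ) n : Finset ℤ) := by
    intro p hp
    obtain ⟨h1, h2, h3, h4⟩ := hF' p hp
    have h1' : (1:ℝ) ≤ p.1 := by exact_mod_cast h1
    simp only [Finset.coe_Icc, Set.mem_Icc]
    refine ⟨h1, ?_⟩
    have e2 : 0 ≤ (p.2.1:ℝ)^2/b^2 := by positivity
    have e3 : 0 ≤ (p.2.2:ℝ)^2/c^2 := by positivity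
    have e1 : (p.1:ℝ)^2/a^2 ≤ r^2 := by linarith
    rw [div_le_iff₀ (by positivity)] at e1
    have e4 : (p.1:ℝ) ≤ a * r := by
      apply le_of_sq_le_sq _ (by positivity)
      nlinarith
    have e5 : (p.1:ℝ) < ((n:ℤ)+1 : ℤ) := by push_cast; linarith
    have e6 : p.1 < (n:ℤ)+1 := by exact_mod_cast e5
    omega
  have hsum : (F.card : ℝ) ≤ ∑ i ∈ Finset.Icc (1:ℤ) n,
      (b * c * cubV * r^2 - (i:ℝ)^2 * (b * c * cubV / a^2)) := by
    rw [Finset.card_eq_sum_card_fiberwise hmaps, Nat.cast_sum]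
    apply Finset.sum_le_sum
    intro i hi
    rw [Finset.mem_Icc] at hi
    have hi1 : (1:ℝ) ≤ i := by exact_mod_cast hi.1
    have hi2 : (i:ℝ) ≤ n := by exact_mod_cast hi.2
    have hs : 0 ≤ r^2 - (i:ℝ)^2/a^2 := by
      rw [sub_nonneg, div_le_iff₀ (by positivity), ← mul_pow]
      apply pow_le_pow_left₀ (by linarith)
      linarith
    have hcard : (F.filter (fun p => p.1 = i)).card
        = ((F.filter (fun p => p.1 = i)).image Prod.snd).card := by
      rw [Finset.card_image_of_injOn]
      intro p hp q hq h
      simp only [Finset.coe_filter, Set.mem_ofPred_eq] at hp hq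
      exact Prod.ext (hp.2.trans hq.2.symm) h
    rw [hcard]
    refine (cub_card_le _ b c (r^2 - (i:ℝ)^2/a^2) hb hc hs ?_).trans (le_of_eq (by ring))
    intro q hq
    rw [Finset.mem_image] at hq
    obtain ⟨p, hp, rfl⟩ := hq
    rw [Finset.mem_filter] at hp
    obtain ⟨h1, h2, h3, h4⟩ := hF' p hp.1
    rw [hp.2] at h4
    exact ⟨h2, h3, by linarith⟩
  rw [eF]
  refine hsum.trans ?_
  rw [cub_sum_eq]
  have hb1 := cub_sum_bound n (a*r) hn1 hnle hnlt
  have hbc : b * c = 1 / a := by field_simp; linarith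
  rw [hbc]
  have hV := cubV_pos
  have h3 : 0 ≤ cubV / a^3 := by positivity
  have := mul_le_mul_of_nonneg_left hb1 h3
  calc _ = cubV / a^3 * ((n:ℝ) * (a*r)^2 - (n:ℝ) * (n+1) * (2*n+1) / 6) := by field_simp
    _ ≤ _ := this
    _ = _ := by field_simp

/-- volume of the octant of the ball -/
theorem cub_oct (ρ : ℝ) (hρ : 0 ≤ ρ) :
    volume {p : ℝ × ℝ × ℝ | 0 < p.1 ∧ 0 < p.2.1 ∧ 0 < p.2.2 ∧ p.1^2 + p.2.1^2 + p.2.2^2 ≤ ρ^2}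
      = ENNReal.ofReal (cubV * (2/3 * ρ^3)) := by
  have hm : MeasurableSet {p : ℝ × ℝ × ℝ | 0 < p.1 ∧ 0 < p.2.1 ∧ 0 < p.2.2 ∧
      p.1^2 + p.2.1^2 + p.2.2^2 ≤ ρ^2} := by
    rw [Set.ofPred_and]
    refine MeasurableSet.inter (measurableSet_lt (by fun_prop) (by fun_prop)) ?_
    rw [Set.ofPred_and]
    refine MeasurableSet.inter (measurableSet_lt (by fun_prop) (by fun_prop)) ?_
    rw [Set.ofPred_and]
    refine MeasurableSet.inter (measurableSet_lt (by fun_prop) (by fun_prop)) ?_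
    exact measurableSet_le (by fun_prop) (by fun_prop)
  have hV := cubV_pos
  rw [Measure.volume_eq_prod, Measure.prod_apply hm]
  have hsl : ∀ x : ℝ, volume (Prod.mk x ⁻¹' {p : ℝ × ℝ × ℝ | 0 < p.1 ∧ 0 < p.2.1 ∧ 0 < p.2.2 ∧
      p.1^2 + p.2.1^2 + p.2.2^2 ≤ ρ^2})
      = (Set.Ioc 0 ρ).indicator (fun x => ENNReal.ofReal (cubV * (ρ^2 - x^2))) x := by
    intro x
    by_cases hx : x ∈ Set.Ioc 0 ρ
    · rw [Set.indicator_of_mem hx]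
      have hs : 0 ≤ ρ^2 - x^2 := by nlinarith [hx.1, hx.2]
      have := cub_ell' 1 1 (ρ^2 - x^2) one_pos one_pos hs
      have e : cubV * (ρ^2 - x^2) = 1 * 1 * (ρ^2-x^2) * cubV := by ring
      rw [e, ← this]
      congr 1
      ext ⟨y, z⟩
      simp only [Set.mem_preimage, Set.mem_ofPred_eq, one_pow, div_one]
      constructor
      · rintro ⟨h1, h2, h3, h4⟩
        exact ⟨h2, h3, by linarith⟩
      · rintro ⟨h2, h3, h4⟩
        exact ⟨hx.1, h2, h3, by linarith⟩
    · rw [Set.indicator_of_notMem hx]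
      convert measure_empty (μ := (volume : Measure (ℝ × ℝ)))
      ext ⟨y, z⟩
      simp only [Set.mem_preimage, Set.mem_ofPred_eq, Set.mem_empty_iff_false, iff_false]
      rintro ⟨h1, h2, h3, h4⟩
      apply hx
      refine ⟨h1, ?_⟩
      apply le_of_sq_le_sq _ hρ
      nlinarith
  simp_rw [hsl]
  rw [lintegral_indicator measurableSet_Ioc, ← ofReal_integral_eq_lintegral_ofReal]
  · rw [← intervalIntegral.integral_of_le hρ]
    congr 1
    rw [intervalIntegral.integral_const_mul, intervalIntegral.integral_sub (by simp) (by simp)]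
    rw [intervalIntegral.integral_const, integral_pow, smul_eq_mul]
    push_cast
    ring
  · have : Continuous (fun x : ℝ => cubV * (ρ^2 - x^2)) := by fun_prop
    exact this.integrableOn_Ioc
  · refine (ae_restrict_iff' measurableSet_Ioc).2 (Filter.Eventually.of_forall ?_)
    intro x hx
    have hs : 0 ≤ ρ^2 - x^2 := by nlinarith [hx.1, hx.2]
    simp only [Pi.zero_apply]
    positivity

/-- lower bound for the counting function of the cube -/
theorem cub_lower (r : ℝ) (hr : 0 < r) :
    cubV * (2/3 * (r^3 - 3 * √3 * r^2)) ≤ (cuboidCount 1 1 1 (Real.pi^2 * r^2) : ℝ) := by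
  have hV := cubV_pos
  have h3 : √3 * √3 = 3 := Real.mul_self_sqrt (by norm_num)
  have h3p : 0 < √3 := by positivity
  rcases lt_or_ge r (√3) with hlt | hge
  · refine le_trans ?_ (Nat.cast_nonneg _)
    apply mul_nonpos_of_nonneg_of_nonpos hV.le
    have : r^3 - 3 * √3 * r^2 = r^2 * (r - 3 * √3) := by ring
    rw [this]
    have : r^2 * (r - 3 * √3) ≤ 0 :=
      mul_nonpos_of_nonneg_of_nonpos (by positivity) (by linarith)
    linarith
  set ρ := r - √3 with hρ
  have hρ0 : 0 ≤ ρ := by linarith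
  obtain ⟨F, hF, eF⟩ := cub_finset 1 1 1 (Real.pi^2 * r^2) one_pos one_pos one_pos
  set sq : ℤ × ℤ × ℤ → Set (ℝ × ℝ × ℝ) := fun p => Set.Ioc ((p.1:ℝ)-1) p.1 ×ˢ
    (Set.Ioc ((p.2.1:ℝ)-1) p.2.1 ×ˢ Set.Ioc ((p.2.2:ℝ)-1) p.2.2) with hsq
  have hsub : {p : ℝ × ℝ × ℝ | 0 < p.1 ∧ 0 < p.2.1 ∧ 0 < p.2.2 ∧
      p.1^2 + p.2.1^2 + p.2.2^2 ≤ ρ^2} ⊆ ⋃ p ∈ F, sq p := by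
    rintro ⟨x, y, z⟩ ⟨hx, hy, hz, h⟩
    simp only at hx hy hz h
    have cx := Int.le_ceil x
    have cy := Int.le_ceil y
    have cz := Int.le_ceil z
    have dx := Int.ceil_lt_add_one x
    have dy := Int.ceil_lt_add_one y
    have dz := Int.ceil_lt_add_one z
    simp only [Set.mem_iUnion]
    refine ⟨(⌈x⌉, ⌈y⌉, ⌈z⌉), ?_, ⟨by simp only; linarith, cx⟩, ⟨by simp only; linarith, cy⟩,
      ⟨by simp only; linarith, cz⟩⟩
    rw [hF]
    refine ⟨Int.one_le_ceil_iff.2 hx, Int.one_le_ceil_iff.2 hy, Int.one_le_ceil_iff.2 hz, ?_⟩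
    simp only [one_pow, div_one]
    apply mul_le_mul_of_nonneg_left _ (by positivity)
    have hsum : x + y + z ≤ √3 * ρ := by
      apply le_of_sq_le_sq _ (by positivity)
      nlinarith [sq_nonneg (x-y), sq_nonneg (y-z), sq_nonneg (x-z)]
    have hr' : r = ρ + √3 := by rw [hρ]; ring
    have s1 : (⌈x⌉:ℝ)^2 ≤ (x+1)^2 := pow_le_pow_left₀ (by linarith) dx.le 2
    have s2 : (⌈y⌉:ℝ)^2 ≤ (y+1)^2 := pow_le_pow_left₀ (by linarith) dy.le 2
    have s3 : (⌈z⌉:ℝ)^2 ≤ (z+1)^2 := pow_le_pow_left₀ (by linarith) dz.le 2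
    rw [hr']
    nlinarith
  have hm := (measure_mono (μ := volume) hsub).trans (measure_biUnion_finset_le F sq)
  rw [cub_oct ρ hρ0, Finset.sum_congr rfl (g := fun _ => (1:ENNReal))] at hm
  · have h' : ENNReal.ofReal (cubV * (2/3 * ρ^3)) ≤ ENNReal.ofReal (F.card : ℝ) := by
      rw [ENNReal.ofReal_natCast]; simpa using hm
    rw [ENNReal.ofReal_le_ofReal_iff (by positivity)] at h'
    rw [eF]
    refine le_trans ?_ h'
    apply mul_le_mul_of_nonneg_left _ hV.le
    apply mul_le_mul_of_nonneg_left _ (by norm_num)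
    have : ρ^3 = r^3 - 3*√3*r^2 + (√3*√3)*(3*r) - (√3*√3)*√3 := by rw [hρ]; ring
    rw [this, h3]
    linarith
  · intro p _
    rw [hsq, Measure.volume_eq_prod, Measure.prod_prod, Measure.volume_eq_prod, Measure.prod_prod]
    simp

/-- For every `k ≥ 1`, any minimiser `(a₁*,a₂*,a₃*)` for `λ_k` satisfies
`a₁* ≥ 1/(4 + 8√3)`. -/
theorem minimiser_shortest_side_ge (k : ℕ) (hk : 1 ≤ k) (a₁ a₂ a₃ : ℝ)
    (hmin : IsMinimiser k a₁ a₂ a₃) : 1 / (4 + 8 * Real.sqrt 3) ≤ a₁ := by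
  obtain ⟨h1, h12, h23, hprod, hle⟩ := hmin
  have h2 : 0 < a₂ := by linarith
  have h3 : 0 < a₃ := by linarith
  have hcube := hle 1 1 1 one_pos le_rfl le_rfl (by norm_num)
  have hV := cubV_pos
  set L := cuboidEig a₁ a₂ a₃ k with hL
  have hlb : Real.pi^2 / a₁^2 ≤ L := by
    apply le_csInf (cub_nonempty a₁ a₂ a₃ h1 h2 h3 k)
    intro l hl
    exact cub_pos_count a₁ a₂ a₃ l h1 h2 h3 (hk.trans hl)
  have hpi := Real.pi_pos
  have hL0 : 0 < L := lt_of_lt_of_le (by positivity) hlb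
  set R := √L / Real.pi with hR
  have hR2 : Real.pi^2 * R^2 = L := by
    rw [hR, div_pow, Real.sq_sqrt hL0.le]; field_simp
  have hR0 : 0 < R := by positivity
  have haR : 1 ≤ a₁ * R := by
    rw [← hR2, div_le_iff₀ (by positivity)] at hlb
    have : 1 ≤ (a₁ * R)^2 := by
      have : Real.pi^2 * 1 ≤ Real.pi^2 * (a₁*R)^2 := by nlinarith
      exact le_of_mul_le_mul_left this (by positivity)
    nlinarith [mul_pos h1 hR0]
  -- counts above and below
  have hup : ∀ r', R < r' → (k:ℝ) ≤ cubV * (2/3 * r'^3 - r'^2 / (4*a₁)) := by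
    intro r' hr'
    have hlt : L < Real.pi^2 * r'^2 := by
      rw [← hR2]; gcongr
    obtain ⟨l, hl, hl2⟩ := exists_lt_of_csInf_lt (cub_nonempty a₁ a₂ a₃ h1 h2 h3 k) hlt
    have hk1 : k ≤ cuboidCount a₁ a₂ a₃ (Real.pi^2 * r'^2) :=
      le_trans hl (cub_mono a₁ a₂ a₃ _ _ h1 h2 h3 hl2.le)
    have hk2 : (k:ℝ) ≤ (cuboidCount a₁ a₂ a₃ (Real.pi^2 * r'^2) : ℝ) := by exact_mod_cast hk1
    refine hk2.trans (cub_upper a₁ a₂ a₃ r' h1 h2 h3 hprod (by linarith) ?_)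
    nlinarith
  have hdown : ∀ r, 0 < r → r < R → cubV * (2/3 * (r^3 - 3 * √3 * r^2)) ≤ (k:ℝ) := by
    intro r hr0 hr
    refine (cub_lower r hr0).trans ?_
    have hlt : Real.pi^2 * r^2 < cuboidEig 1 1 1 k := by
      refine lt_of_lt_of_le ?_ hcube
      rw [← hR2]; gcongr
    have hnot : ¬ (k ≤ cuboidCount 1 1 1 (Real.pi^2 * r^2)) := by
      intro hmem
      have hmem' : Real.pi^2 * r^2 ∈ {lam : ℝ | k ≤ cuboidCount 1 1 1 lam} := hmem
      refine absurd (csInf_le ?_ hmem') (not_le.2 hlt)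
      refine ⟨Real.pi^2/1^2, ?_⟩
      intro l hl
      exact cub_pos_count 1 1 1 l one_pos one_pos one_pos (hk.trans hl)
    exact_mod_cast (not_le.1 hnot).le
  have hup' : (k:ℝ) ≤ cubV * (2/3 * R^3 - R^2 / (4*a₁)) := by
    have hc : Continuous (fun x : ℝ => cubV * (2/3 * x^3 - x^2 / (4*a₁))) := by fun_prop
    refine ge_of_tendsto (hc.continuousWithinAt (s := Set.Ioi R)).tendsto ?_
    filter_upwards [self_mem_nhdsWithin] with x hx using hup x hx
  have hdown' : cubV * (2/3 * (R^3 - 3 * √3 * R^2)) ≤ (k:ℝ) := by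
    have hc : Continuous (fun x : ℝ => cubV * (2/3 * (x^3 - 3 * √3 * x^2))) := by fun_prop
    refine le_of_tendsto (hc.continuousWithinAt (s := Set.Iio R)).tendsto ?_
    filter_upwards [Ioo_mem_nhdsLT hR0] with x hx using hdown x hx.1 hx.2
  have hfin := le_of_mul_le_mul_left (hdown'.trans hup') hV
  have h3p : 0 < √3 := by positivity
  have h4 : R^2 * (1 / (4*a₁)) ≤ R^2 * (2 * √3) := by
    have : R^2 / (4*a₁) = R^2 * (1 / (4*a₁)) := by ring
    rw [← this]; linarith
  have h5 := le_of_mul_le_mul_left h4 (by positivity)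
  rw [div_le_iff₀ (by positivity)] at h5
  rw [div_le_iff₀ (by positivity)]
  nlinarith
end

section
/- For every integer k ≥ 1 and every minimiser (a₁*, a₂*, a₃*) for λ_k, one has ν_k^{3/2} − 6π²k > 0 and a₁* ≥ 3π·ν_k / (8(ν_k^{3/2} − 6π²k)). -/
/-- Finite index set covering the lattice points counted by `cuboidCount`. -/
noncomputable def cuboidIdx (a b c L : ℝ) : Finset (Σ _ : ℕ, Σ _ : ℕ, ℕ) :=
  (Finset.range ⌊a * √L⌋₊).sigma fun i =>
    (Finset.range ⌊b * √(L - ((i + 1 : ℕ) : ℝ) ^ 2 / a ^ 2)⌋₊).sigma fun j =>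
      Finset.range ⌊c * √(L - ((i + 1 : ℕ) : ℝ) ^ 2 / a ^ 2 - ((j + 1 : ℕ) : ℝ) ^ 2 / b ^ 2)⌋₊

lemma toNat_cast_aux (i : ℤ) (hi : 1 ≤ i) : (((i - 1).toNat + 1 : ℕ) : ℝ) = (i : ℝ) := by
  have h : (((i - 1).toNat + 1 : ℕ) : ℤ) = i := by omega
  exact_mod_cast congrArg (fun z : ℤ => (z : ℝ)) h

lemma mem_range_floor_aux (a T : ℝ) (ha : 0 < a) (i : ℤ) (hi : 1 ≤ i)
    (h : (i : ℝ) ^ 2 / a ^ 2 ≤ T) : (i - 1).toNat ∈ Finset.range ⌊a * √T⌋₊ := by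
  rw [Finset.mem_range, ← Nat.add_one_le_iff]
  apply Nat.le_floor
  rw [toNat_cast_aux i hi]
  have h1 : (i : ℝ) / a ≤ √T := by
    apply Real.le_sqrt_of_sq_le
    rwa [div_pow]
  rw [div_le_iff₀ ha] at h1
  linarith

lemma cuboid_embed (a b c lam : ℝ) (ha : 0 < a) (hb : 0 < b) (hc : 0 < c) :
    ∃ f : {p : ℤ × ℤ × ℤ //
      1 ≤ p.1 ∧ 1 ≤ p.2.1 ∧ 1 ≤ p.2.2 ∧
      Real.pi ^ 2 * ((p.1 : ℝ) ^ 2 / a ^ 2 + (p.2.1 : ℝ) ^ 2 / b ^ 2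
        + (p.2.2 : ℝ) ^ 2 / c ^ 2) ≤ lam} → cuboidIdx a b c (lam / Real.pi ^ 2),
      Function.Injective f := by
  refine ⟨fun p => ⟨⟨(p.1.1 - 1).toNat, ⟨(p.1.2.1 - 1).toNat, (p.1.2.2 - 1).toNat⟩⟩, ?_⟩, ?_⟩
  · obtain ⟨⟨i, j, l⟩, hi, hj, hl, h⟩ := p
    simp only at hi hj hl h
    have hpi : 0 < Real.pi ^ 2 := by positivity
    have h' : (i : ℝ) ^ 2 / a ^ 2 + (j : ℝ) ^ 2 / b ^ 2 + (l : ℝ) ^ 2 / c ^ 2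
        ≤ lam / Real.pi ^ 2 := by
      rw [le_div_iff₀ hpi]; linarith
    have p1 : 0 ≤ (i : ℝ) ^ 2 / a ^ 2 := by positivity
    have p2 : 0 ≤ (j : ℝ) ^ 2 / b ^ 2 := by positivity
    have p3 : 0 ≤ (l : ℝ) ^ 2 / c ^ 2 := by positivity
    simp only [cuboidIdx, Finset.mem_sigma, toNat_cast_aux i hi, toNat_cast_aux j hj]
    refine ⟨?_, ?_, ?_⟩ <;> apply mem_range_floor_aux <;> first | assumption | linarith
  · rintro ⟨⟨i, j, l⟩, hi, hj, hl, h⟩ ⟨⟨i', j', l'⟩, hi', hj', hl', h'⟩ he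
    simp only [Subtype.mk.injEq, Sigma.mk.injEq, heq_eq_eq] at he
    simp only at hi hj hl hi' hj' hl'
    simp only [Subtype.mk.injEq, Prod.mk.injEq]
    omega

lemma cuboid_finite (a b c lam : ℝ) (ha : 0 < a) (hb : 0 < b) (hc : 0 < c) :
    Finite {p : ℤ × ℤ × ℤ //
      1 ≤ p.1 ∧ 1 ≤ p.2.1 ∧ 1 ≤ p.2.2 ∧
      Real.pi ^ 2 * ((p.1 : ℝ) ^ 2 / a ^ 2 + (p.2.1 : ℝ) ^ 2 / b ^ 2
        + (p.2.2 : ℝ) ^ 2 / c ^ 2) ≤ lam} := by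
  obtain ⟨f, hf⟩ := cuboid_embed a b c lam ha hb hc
  exact Finite.of_injective f hf

lemma cuboidCount_mono (a b c : ℝ) (ha : 0 < a) (hb : 0 < b) (hc : 0 < c) {x y : ℝ}
    (h : x ≤ y) : cuboidCount a b c x ≤ cuboidCount a b c y := by
  have := cuboid_finite a b c y ha hb hc
  unfold cuboidCount
  refine Nat.card_le_card_of_injective
    (fun p => ⟨p.1, p.2.1, p.2.2.1, p.2.2.2.1, p.2.2.2.2.trans h⟩) ?_
  intro p q hpq
  simp only [Subtype.mk.injEq] at hpq
  exact Subtype.ext hpq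

lemma cuboid_nonempty (a b c : ℝ) (k : ℕ) (ha : 0 < a) (hb : 0 < b) (hc : 0 < c) :
    {lam : ℝ | k ≤ cuboidCount a b c lam}.Nonempty := by
  set lam : ℝ := Real.pi ^ 2 * ((k : ℝ) ^ 2 / a ^ 2 + (1 : ℝ) ^ 2 / b ^ 2
        + (1 : ℝ) ^ 2 / c ^ 2) with hlam
  refine ⟨lam, ?_⟩
  have := cuboid_finite a b c lam ha hb hc
  have := Nat.card_le_card_of_injective (α := Fin k) (β := {p : ℤ × ℤ × ℤ //
      1 ≤ p.1 ∧ 1 ≤ p.2.1 ∧ 1 ≤ p.2.2 ∧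
      Real.pi ^ 2 * ((p.1 : ℝ) ^ 2 / a ^ 2 + (p.2.1 : ℝ) ^ 2 / b ^ 2
        + (p.2.2 : ℝ) ^ 2 / c ^ 2) ≤ lam})
    (fun i => ⟨((i : ℕ) + 1, 1, 1), by simp, by simp, by simp, by
      have h1 : ((i : ℕ) : ℝ) + 1 ≤ k := by exact_mod_cast i.2
      rw [hlam]
      push_cast
      gcongr⟩) (by
      intro i j hij
      simp only [Subtype.mk.injEq, Prod.mk.injEq, and_true] at hij
      apply Fin.ext
      omega)
  simpa [cuboidCount] using this

lemma quarter_circle : ∫ x in (0 : ℝ)..1, √(1 - x ^ 2) = Real.pi / 4 := by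
  have h := integral_sqrt_one_sub_sq
  have hi : ∀ u v : ℝ, IntervalIntegrable (fun x : ℝ => √(1 - x ^ 2)) MeasureTheory.volume u v :=
    fun u v => (by fun_prop : Continuous fun x : ℝ => √(1 - x ^ 2)).intervalIntegrable u v
  have h1 := intervalIntegral.integral_add_adjacent_intervals (hi (-1) 0) (hi 0 1)
  have h2 : ∫ x in (-1 : ℝ)..0, √(1 - x ^ 2) = ∫ x in (0 : ℝ)..1, √(1 - x ^ 2) := by
    have := intervalIntegral.integral_comp_neg (a := 0) (b := 1) (fun x : ℝ => √(1 - x ^ 2))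
    simpa using this.symm
  linarith

lemma ellipse_integral (b T : ℝ) (hb : 0 < b) (hT : 0 < T) :
    ∫ x in (0 : ℝ)..(b * √T), √(T - x ^ 2 / b ^ 2) = Real.pi / 4 * b * T := by
  have hs : 0 < √T := Real.sqrt_pos.2 hT
  have hd : b * √T ≠ 0 := by positivity
  have h := intervalIntegral.integral_comp_div (a := 0) (b := b * √T)
    (fun x : ℝ => √(1 - x ^ 2)) hd
  rw [zero_div, div_self hd, quarter_circle] at h
  have h2 : ∀ x : ℝ, √(T - x ^ 2 / b ^ 2) = √T * √(1 - (x / (b * √T)) ^ 2) := by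
    intro x
    rw [← Real.sqrt_mul hT.le]
    congr 1
    rw [div_pow, mul_pow, Real.sq_sqrt hT.le]
    field_simp
  simp only [h2]
  rw [intervalIntegral.integral_const_mul, h, smul_eq_mul]
  have := Real.mul_self_sqrt hT.le
  linear_combination (b * Real.pi / 4) * this

lemma slice_bound (b c T : ℝ) (hb : 0 < b) (hc : 0 < c) (hT : 0 ≤ T) :
    ∑ j ∈ Finset.range ⌊b * √T⌋₊, ((⌊c * √(T - ((j + 1 : ℕ) : ℝ) ^ 2 / b ^ 2)⌋₊ : ℕ) : ℝ)
      ≤ Real.pi / 4 * b * c * T := by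
  rcases hT.eq_or_lt with rfl | hT
  · simp
  have hcont : Continuous fun x : ℝ => √(T - x ^ 2 / b ^ 2) := by fun_prop
  have hA : AntitoneOn (fun x : ℝ => √(T - x ^ 2 / b ^ 2))
      (Set.Icc 0 (0 + ((⌊b * √T⌋₊ : ℕ) : ℝ))) := by
    intro x hx y hy hxy
    have := hx.1
    dsimp only
    gcongr
  have h1 := hA.sum_le_integral
  simp only [zero_add] at h1
  have h2 : ∫ x in (0 : ℝ)..((⌊b * √T⌋₊ : ℕ) : ℝ), √(T - x ^ 2 / b ^ 2)
      ≤ ∫ x in (0 : ℝ)..(b * √T), √(T - x ^ 2 / b ^ 2) := by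
    apply intervalIntegral.integral_mono_interval le_rfl (by positivity)
      (Nat.floor_le (by positivity))
    · exact Filter.Eventually.of_forall fun x => Real.sqrt_nonneg _
    · exact hcont.intervalIntegrable _ _
  rw [ellipse_integral b T hb hT] at h2
  calc _ ≤ ∑ j ∈ Finset.range ⌊b * √T⌋₊, c * √(T - ((j + 1 : ℕ) : ℝ) ^ 2 / b ^ 2) :=
        Finset.sum_le_sum fun j _ => Nat.floor_le (by positivity)
    _ = c * ∑ j ∈ Finset.range ⌊b * √T⌋₊, √(T - ((j + 1 : ℕ) : ℝ) ^ 2 / b ^ 2) := by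
        rw [Finset.mul_sum]
    _ ≤ c * (Real.pi / 4 * b * T) := by gcongr; exact h1.trans h2
    _ = _ := by ring

lemma sum_sq_aux (R : ℝ) (n : ℕ) :
    ∑ i ∈ Finset.range n, (R ^ 2 - ((i + 1 : ℕ) : ℝ) ^ 2)
      = n * R ^ 2 - n * (n + 1) * (2 * n + 1) / 6 := by
  induction n with
  | zero => simp
  | succ n ih => rw [Finset.sum_range_succ, ih]; push_cast; ring

lemma sum_bound (R : ℝ) (hR : 1 ≤ R) :
    ∑ i ∈ Finset.range ⌊R⌋₊, (R ^ 2 - ((i + 1 : ℕ) : ℝ) ^ 2) ≤ 2 / 3 * R ^ 3 - R ^ 2 / 4 := by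
  rw [sum_sq_aux]
  have h1 : (1 : ℝ) ≤ (⌊R⌋₊ : ℝ) := by exact_mod_cast (Nat.one_le_floor_iff R).2 hR
  have h2 : (⌊R⌋₊ : ℝ) ≤ R := Nat.floor_le (by linarith)
  have h3 : R < (⌊R⌋₊ : ℝ) + 1 := Nat.lt_floor_add_one R
  generalize (⌊R⌋₊ : ℝ) = n at *
  obtain ⟨t, rfl⟩ : ∃ t, R = n + t := ⟨R - n, by ring⟩
  have ht0 : 0 ≤ t := by linarith
  have ht1 : t ≤ 1 := by linarith
  have e1 : 0 ≤ n * (t ^ 2 - t / 2 + 1 / 6) := by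
    apply mul_nonneg (by linarith); nlinarith [sq_nonneg (t - 1 / 4)]
  have e2 : 0 ≤ (n ^ 2 - t ^ 2) / 4 := by nlinarith
  have e3 : 0 ≤ t ^ 3 := by positivity
  nlinarith

lemma count_bound (a b c lam : ℝ) (ha : 0 < a) (hb : 0 < b) (hc : 0 < c) (habc : a * b * c = 1)
    (hpos : 1 ≤ cuboidCount a b c lam) :
    (cuboidCount a b c lam : ℝ) ≤
      lam ^ ((3 : ℝ) / 2) / (6 * Real.pi ^ 2) - lam / (16 * Real.pi * a) := by
  have hpi := Real.pi_pos
  obtain ⟨f, hf⟩ := cuboid_embed a b c lam ha hb hc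
  have hle : cuboidCount a b c lam ≤ (cuboidIdx a b c (lam / Real.pi ^ 2)).card := by
    have := Nat.card_le_card_of_injective f hf
    simpa [cuboidCount] using this
  set L := lam / Real.pi ^ 2 with hL
  have hlam : lam = Real.pi ^ 2 * L := by rw [hL]; field_simp
  -- R ≥ 1
  have hR : 1 ≤ a * √L := by
    by_contra hlt
    have : ⌊a * √L⌋₊ = 0 := Nat.floor_eq_zero.2 (not_le.1 hlt)
    simp [cuboidIdx, this] at hle
    omega
  have hs : 0 < √L := by
    by_contra h
    have : √L = 0 := le_antisymm (not_lt.1 h) (Real.sqrt_nonneg _)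
    rw [this] at hR; norm_num at hR
  have hLpos : 0 < L := Real.sqrt_pos.1 hs
  have hsq : √L ^ 2 = L := Real.sq_sqrt hLpos.le
  have hcard : ((cuboidIdx a b c L).card : ℝ) ≤
      ∑ i ∈ Finset.range ⌊a * √L⌋₊, Real.pi / 4 * b * c * (L - ((i + 1 : ℕ) : ℝ) ^ 2 / a ^ 2) := by
    simp only [cuboidIdx, Finset.card_sigma, Finset.card_range]
    rw [Nat.cast_sum]
    apply Finset.sum_le_sum
    intro i hi
    rw [Nat.cast_sum]
    apply slice_bound b c _ hb hc
    rw [Finset.mem_range, ← Nat.add_one_le_iff] at hi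
    have h1 : ((i + 1 : ℕ) : ℝ) ≤ a * √L :=
      (Nat.cast_le.2 hi).trans (Nat.floor_le (by positivity))
    have h2 : ((i + 1 : ℕ) : ℝ) ^ 2 ≤ (a * √L) ^ 2 := by gcongr
    rw [mul_pow, hsq] at h2
    rw [sub_nonneg, div_le_iff₀ (by positivity)]
    linarith
  have hsum : ∑ i ∈ Finset.range ⌊a * √L⌋₊,
      Real.pi / 4 * b * c * (L - ((i + 1 : ℕ) : ℝ) ^ 2 / a ^ 2)
      = Real.pi / 4 / a ^ 3 *
        ∑ i ∈ Finset.range ⌊a * √L⌋₊, ((a * √L) ^ 2 - ((i + 1 : ℕ) : ℝ) ^ 2) := by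
    rw [Finset.mul_sum]
    apply Finset.sum_congr rfl
    intro i _
    have hbc : b * c = 1 / a := by field_simp; linarith
    rw [mul_pow, hsq, mul_assoc (Real.pi / 4), hbc]
    field_simp
  have hb2 := sum_bound (a * √L) hR
  have hpow : lam ^ ((3 : ℝ) / 2) = Real.pi ^ 3 * √L ^ 3 := by
    have e : lam = (Real.pi * √L) ^ (2 : ℝ) := by
      rw [Real.rpow_two, mul_pow, hsq, hlam]
    rw [e, ← Real.rpow_mul (by positivity)]
    norm_num
    rw [mul_pow]
  calc (cuboidCount a b c lam : ℝ) ≤ ((cuboidIdx a b c L).card : ℝ) := by exact_mod_cast hle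
    _ ≤ _ := hcard
    _ = _ := hsum
    _ ≤ Real.pi / 4 / a ^ 3 * (2 / 3 * (a * √L) ^ 3 - (a * √L) ^ 2 / 4) := by gcongr
    _ = _ := by
      rw [hpow, hlam]
      nth_rewrite 4 [← hsq]
      field_simp
      ring

/-- For every `k ≥ 1` and any minimiser `(a₁*,a₂*,a₃*)` for `λ_k`, with `ν_k` the `k`-th
Dirichlet eigenvalue of the unit cube, one has `ν_k^{3/2} − 6π²k > 0` and
`a₁* ≥ 3πν_k/(8(ν_k^{3/2} − 6π²k))`. -/
theorem minimiser_shortest_side_ge_cube (k : ℕ) (hk : 1 ≤ k) (a₁ a₂ a₃ : ℝ)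
    (hmin : IsMinimiser k a₁ a₂ a₃) :
    0 < (cuboidEig 1 1 1 k) ^ ((3 : ℝ) / 2) - 6 * Real.pi ^ 2 * k ∧
    3 * Real.pi * cuboidEig 1 1 1 k
        / (8 * ((cuboidEig 1 1 1 k) ^ ((3 : ℝ) / 2) - 6 * Real.pi ^ 2 * k)) ≤ a₁ := by
  obtain ⟨ha, hab, hbc, habc, hmin⟩ := hmin
  have hb : 0 < a₂ := by linarith
  have hc : 0 < a₃ := by linarith
  have hle := hmin 1 1 1 one_pos le_rfl le_rfl (by norm_num)
  have hpi := Real.pi_pos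
  have hnu : 0 < cuboidEig 1 1 1 k := by
    have : Real.pi ^ 2 ≤ cuboidEig 1 1 1 k := by
      apply le_csInf (cuboid_nonempty 1 1 1 k one_pos one_pos one_pos)
      intro lam hlam
      have h1 : 0 < cuboidCount 1 1 1 lam := lt_of_lt_of_le hk hlam
      obtain ⟨⟨⟨i, j, l⟩, hi, hj, hl, h⟩⟩ := (Nat.card_pos_iff.1 h1).1
      simp only at hi hj hl h
      have hi' : (1 : ℝ) ≤ i := by exact_mod_cast hi
      have h2 : 1 ≤ (i : ℝ) ^ 2 / 1 ^ 2 + (j : ℝ) ^ 2 / 1 ^ 2 + (l : ℝ) ^ 2 / 1 ^ 2 := by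
        nlinarith [sq_nonneg (j : ℝ), sq_nonneg (l : ℝ)]
      exact le_trans (le_mul_of_one_le_right (by positivity) h2) h
    exact lt_of_lt_of_le (by positivity) this
  set ν := cuboidEig 1 1 1 k with hν
  have key : ∀ μ > ν, (k : ℝ) ≤ μ ^ ((3 : ℝ) / 2) / (6 * Real.pi ^ 2) - μ / (16 * Real.pi * a₁) := by
    intro μ hμ
    obtain ⟨lam, hlam, hlt⟩ := exists_lt_of_csInf_lt (cuboid_nonempty a₁ a₂ a₃ k ha hb hc)
      (lt_of_le_of_lt hle hμ)
    have h1 : k ≤ cuboidCount a₁ a₂ a₃ μ :=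
      le_trans hlam (cuboidCount_mono a₁ a₂ a₃ ha hb hc hlt.le)
    exact le_trans (by exact_mod_cast h1)
      (count_bound a₁ a₂ a₃ μ ha hb hc habc (hk.trans h1))
  have hcont : Continuous fun μ : ℝ =>
      μ ^ ((3 : ℝ) / 2) / (6 * Real.pi ^ 2) - μ / (16 * Real.pi * a₁) :=
    ((Real.continuous_rpow_const (by norm_num)).div_const _).sub (continuous_id.div_const _)
  have hk2 : (k : ℝ) ≤ ν ^ ((3 : ℝ) / 2) / (6 * Real.pi ^ 2) - ν / (16 * Real.pi * a₁) := by
    refine ge_of_tendsto (hcont.continuousAt.tendsto.mono_left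
      (nhdsWithin_le_nhds (s := Set.Ioi ν))) ?_
    filter_upwards [self_mem_nhdsWithin] with μ hμ using key μ hμ
  have hk3 : 3 * Real.pi * ν / (8 * a₁) ≤ ν ^ ((3 : ℝ) / 2) - 6 * Real.pi ^ 2 * k := by
    have h := mul_le_mul_of_nonneg_left hk2 (by positivity : 0 ≤ 6 * Real.pi ^ 2)
    have e : 6 * Real.pi ^ 2 *
        (ν ^ ((3 : ℝ) / 2) / (6 * Real.pi ^ 2) - ν / (16 * Real.pi * a₁))
        = ν ^ ((3 : ℝ) / 2) - 3 * Real.pi * ν / (8 * a₁) := by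
      field_simp
      ring
    linarith
  have hD : 0 < ν ^ ((3 : ℝ) / 2) - 6 * Real.pi ^ 2 * k := lt_of_lt_of_le (by positivity) hk3
  refine ⟨hD, ?_⟩
  rw [div_le_iff₀ (by positivity)] at hk3 ⊢
  linarith
end

section
/- For every integer k ≥ 1, ν_k^{3/2} ≤ 6π²k + 3π(1/2 + √3)·ν_k. -/
open MeasureTheory in
/-- The box `∏ [q_i, q_i+1]` in Euclidean space has volume one. -/
lemma aux_box_volume (q : Fin 3 → ℝ) :
    volume {x : EuclideanSpace ℝ (Fin 3) | ∀ i, q i ≤ x i ∧ x i ≤ q i + 1} = 1 := by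
  have h := (EuclideanSpace.volume_preserving_symm_measurableEquiv_toLp (Fin 3)).measure_preimage
    (s := Set.Icc q (fun i => q i + 1)) measurableSet_Icc.nullMeasurableSet
  rw [Real.volume_Icc_pi] at h
  simp at h
  rw [← h]
  congr 1
  ext x
  simp [Set.mem_Icc, Pi.le_def, forall_and]

/-- The lattice points counted by the cube counting function. -/
def auxSet (r : ℝ) : Set (ℤ × ℤ × ℤ) :=
  {p | 1 ≤ p.1 ∧ 1 ≤ p.2.1 ∧ 1 ≤ p.2.2 ∧
    (p.1 : ℝ) ^ 2 + (p.2.1 : ℝ) ^ 2 + (p.2.2 : ℝ) ^ 2 ≤ r ^ 2}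

lemma auxSet_finite (r : ℝ) : (auxSet r).Finite := by
  apply (Set.finite_Icc ((1, 1, 1) : ℤ × ℤ × ℤ) (⌊r ^ 2⌋, ⌊r ^ 2⌋, ⌊r ^ 2⌋)).subset
  rintro ⟨a, b, c⟩ ⟨ha, hb, hc, h⟩
  simp only at ha hb hc h
  have ha' : (1 : ℝ) ≤ a := by exact_mod_cast ha
  have hb' : (1 : ℝ) ≤ b := by exact_mod_cast hb
  have hc' : (1 : ℝ) ≤ c := by exact_mod_cast hc
  simp only [Set.mem_Icc, Prod.mk_le_mk, Int.le_floor]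
  refine ⟨⟨ha, hb, hc⟩, ?_, ?_, ?_⟩ <;> nlinarith

lemma cuboidCount_eq (r : ℝ) :
    cuboidCount 1 1 1 (Real.pi ^ 2 * r ^ 2) = (auxSet r).ncard := by
  unfold cuboidCount
  rw [← Nat.card_coe_set_eq]
  have : ∀ p : ℤ × ℤ × ℤ, (1 ≤ p.1 ∧ 1 ≤ p.2.1 ∧ 1 ≤ p.2.2 ∧
    Real.pi ^ 2 * ((p.1 : ℝ) ^ 2 / 1 ^ 2 + (p.2.1 : ℝ) ^ 2 / 1 ^ 2
      + (p.2.2 : ℝ) ^ 2 / 1 ^ 2) ≤ Real.pi ^ 2 * r ^ 2) ↔ p ∈ auxSet r := by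
    intro p
    have hp : 0 < Real.pi ^ 2 := by positivity
    simp only [auxSet, Set.mem_setOf_eq, one_pow, div_one, mul_le_mul_iff_right₀ hp]
  simp_rw [this]

/-- left end point of the signed interval -/
def auxLeft (s : Bool) (n : ℤ) : ℝ := if s then (n : ℝ) - 1 else -n

lemma auxLeft_spec (x : ℝ) : ∃ s, auxLeft s (⌊|x|⌋ + 1) ≤ x ∧
    x ≤ auxLeft s (⌊|x|⌋ + 1) + 1 := by
  have h1 := Int.floor_le |x|
  have h2 := Int.lt_floor_add_one |x|
  rcases le_total 0 x with h | h
  · refine ⟨true, ?_⟩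
    rw [abs_of_nonneg h] at *
    simp only [auxLeft, if_true]; push_cast
    constructor <;> linarith
  · refine ⟨false, ?_⟩
    rw [abs_of_nonpos h] at *
    simp only [auxLeft, Bool.false_eq_true, if_false]; push_cast
    constructor <;> linarith

/-- Pushing a point to the outer lattice corner increases the norm by at most `√3`. -/
lemma aux_norm (x : EuclideanSpace ℝ (Fin 3)) (r : ℝ) (hx : ‖x‖ < r - √3) :
    (⌊|x 0|⌋ + 1, ⌊|x 1|⌋ + 1, ⌊|x 2|⌋ + 1) ∈ auxSet r := by
  have hn : ‖x‖ ^ 2 = |x 0| ^ 2 + |x 1| ^ 2 + |x 2| ^ 2 := by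
    rw [EuclideanSpace.norm_sq_eq, Fin.sum_univ_three]
    simp
  have h0 := Int.floor_le |x 0|
  have h1 := Int.floor_le |x 1|
  have h2 := Int.floor_le |x 2|
  have p0 : 0 ≤ ⌊|x 0|⌋ := Int.floor_nonneg.2 (abs_nonneg _)
  have p1 : 0 ≤ ⌊|x 1|⌋ := Int.floor_nonneg.2 (abs_nonneg _)
  have p2 : 0 ≤ ⌊|x 2|⌋ := Int.floor_nonneg.2 (abs_nonneg _)
  have q0 : (0 : ℝ) ≤ ⌊|x 0|⌋ := by exact_mod_cast p0
  have q1 : (0 : ℝ) ≤ ⌊|x 1|⌋ := by exact_mod_cast p1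
  have q2 : (0 : ℝ) ≤ ⌊|x 2|⌋ := by exact_mod_cast p2
  refine ⟨by simpa using p0, by simpa using p1, by simpa using p2, ?_⟩
  push_cast
  generalize |x 0| = a at *
  generalize |x 1| = b at *
  generalize |x 2| = c at *
  have hs : √3 ^ 2 = 3 := Real.sq_sqrt (by norm_num)
  have hs0 : 0 ≤ √3 := Real.sqrt_nonneg 3
  have hnn := norm_nonneg x
  have hsum : a + b + c ≤ √3 * ‖x‖ := by
    apply abs_le_of_sq_le_sq' _ (by positivity) |>.2
    rw [mul_pow, hs, hn]
    nlinarith [sq_nonneg (a - b), sq_nonneg (b - c), sq_nonneg (a - c)]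
  have e0 : ((⌊a⌋ : ℝ) + 1) ^ 2 ≤ (a + 1) ^ 2 := by gcongr
  have e1 : ((⌊b⌋ : ℝ) + 1) ^ 2 ≤ (b + 1) ^ 2 := by gcongr
  have e2 : ((⌊c⌋ : ℝ) + 1) ^ 2 ≤ (c + 1) ^ 2 := by gcongr
  have e3 : (‖x‖ + √3) ^ 2 ≤ r ^ 2 := by
    apply pow_le_pow_left₀ (by positivity); linarith
  nlinarith

open MeasureTheory in
lemma aux_count (r : ℝ) (hr : √3 ≤ r) :
    Real.pi / 6 * (r - √3) ^ 3 ≤ ((auxSet r).ncard : ℝ) := by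
  classical
  set S := (auxSet_finite r).toFinset with hS
  let T : Finset ((ℤ × ℤ × ℤ) × (Bool × Bool × Bool)) := S ×ˢ Finset.univ
  let B : ((ℤ × ℤ × ℤ) × (Bool × Bool × Bool)) → Set (EuclideanSpace ℝ (Fin 3)) := fun t =>
    {x | ∀ i, (![auxLeft t.2.1 t.1.1, auxLeft t.2.2.1 t.1.2.1, auxLeft t.2.2.2 t.1.2.2] : Fin 3 → ℝ) i
      ≤ x i ∧ x i ≤ (![auxLeft t.2.1 t.1.1, auxLeft t.2.2.1 t.1.2.1, auxLeft t.2.2.2 t.1.2.2] : Fin 3 → ℝ) i + 1}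
  have hsub : Metric.ball (0 : EuclideanSpace ℝ (Fin 3)) (r - √3) ⊆ ⋃ t ∈ T, B t := by
    intro x hx
    rw [mem_ball_zero_iff] at hx
    have hm := aux_norm x r hx
    obtain ⟨s0, h0⟩ := auxLeft_spec (x 0)
    obtain ⟨s1, h1⟩ := auxLeft_spec (x 1)
    obtain ⟨s2, h2⟩ := auxLeft_spec (x 2)
    refine Set.mem_biUnion (x := ((⌊|x 0|⌋ + 1, ⌊|x 1|⌋ + 1, ⌊|x 2|⌋ + 1), (s0, s1, s2))) ?_ ?_
    · simp only [T, Finset.coe_product, Set.mem_prod]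
      simpa [hS] using hm
    · intro i
      fin_cases i
      · exact h0
      · exact h1
      · exact h2
  have hvol : volume (Metric.ball (0 : EuclideanSpace ℝ (Fin 3)) (r - √3)) ≤ (T.card : ENNReal) := by
    calc _ ≤ volume (⋃ t ∈ T, B t) := measure_mono hsub
      _ ≤ ∑ t ∈ T, volume (B t) := measure_biUnion_finset_le _ _
      _ = ∑ t ∈ T, 1 := Finset.sum_congr rfl fun t _ => aux_box_volume _
      _ = T.card := by simp
  have hT : T.card = (auxSet r).ncard * 8 := by
    simp only [T, Finset.card_product]
    rw [Set.ncard_eq_toFinset_card _ (auxSet_finite r)]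
    simp [hS]
  have h0 : 0 ≤ r - √3 := sub_nonneg.2 hr
  rw [EuclideanSpace.volume_ball_fin_three, ← ENNReal.ofReal_pow h0,
    ← ENNReal.ofReal_mul (by positivity), hT, ← ENNReal.ofReal_natCast,
    ENNReal.ofReal_le_ofReal_iff (by positivity)] at hvol
  push_cast at hvol
  linarith

open Filter Topology

/-- For every `k ≥ 1`, the `k`-th Dirichlet eigenvalue `ν_k` of the unit cube satisfies
`ν_k^{3/2} ≤ 6π²k + 3π(1/2 + √3)ν_k`. -/
theorem cube_eigenvalue_upper_bound (k : ℕ) (hk : 1 ≤ k) :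
    (cuboidEig 1 1 1 k) ^ ((3 : ℝ) / 2)
      ≤ 6 * Real.pi ^ 2 * k
        + 3 * Real.pi * (1 / 2 + Real.sqrt 3) * cuboidEig 1 1 1 k := by
  have hlow : ∀ lam ∈ {lam : ℝ | k ≤ cuboidCount 1 1 1 lam}, 0 ≤ lam := by
    intro lam hlam
    have hpos : 0 < cuboidCount 1 1 1 lam := lt_of_lt_of_le hk hlam
    unfold cuboidCount at hpos
    obtain ⟨⟨p, _, _, _, hp⟩⟩ := (Nat.card_pos_iff.1 hpos).1
    exact le_trans (by positivity) hp
  have hν : 0 ≤ cuboidEig 1 1 1 k := Real.sInf_nonneg hlow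
  have hlt : ∀ lam < cuboidEig 1 1 1 k, cuboidCount 1 1 1 lam < k := by
    intro lam hl
    by_contra hc
    exact notMem_of_lt_csInf hl ⟨0, hlow⟩ (not_lt.1 hc)
  generalize cuboidEig 1 1 1 k = ν at *
  have hpi := Real.pi_pos
  obtain ⟨R, hR0, hR⟩ : ∃ R : ℝ, 0 ≤ R ∧ ν = (Real.pi * R) ^ 2 := by
    refine ⟨√ν / Real.pi, by positivity, ?_⟩
    rw [mul_div_cancel₀ _ hpi.ne', Real.sq_sqrt hν]
  have hpow : ν ^ ((3 : ℝ) / 2) = (Real.pi * R) ^ 3 := by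
    rw [hR, ← Real.rpow_natCast, ← Real.rpow_mul (by positivity), ← Real.rpow_natCast]
    norm_num
  rw [hpow, hR]
  have hs : √3 ^ 2 = 3 := Real.sq_sqrt (by norm_num)
  have hs0 : 0 ≤ √3 := Real.sqrt_nonneg 3
  have hk0 : (0 : ℝ) ≤ k := Nat.cast_nonneg k
  have key : R ^ 3 * Real.pi ≤ 6 * k + 3 * √3 * R ^ 2 * Real.pi := by
    rcases le_or_gt R √3 with h | h
    · have : R ^ 3 ≤ 3 * √3 * R ^ 2 := by nlinarith [mul_nonneg hs0 (sq_nonneg R), mul_nonneg (sub_nonneg.2 h) (sq_nonneg R)]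
      nlinarith
    · have hb : Real.pi / 6 * (R - √3) ^ 3 ≤ k := by
        have hc : Tendsto (fun r : ℝ => Real.pi / 6 * (r - √3) ^ 3) (𝓝[<] R)
            (𝓝 (Real.pi / 6 * (R - √3) ^ 3)) :=
          (Continuous.tendsto (by fun_prop) R).mono_left nhdsWithin_le_nhds
        refine le_of_tendsto hc ?_
        filter_upwards [Ioo_mem_nhdsLT h] with r hr
        refine (aux_count r hr.1.le).trans ?_
        rw [← cuboidCount_eq]
        have hr0 : 0 ≤ r := hs0.trans hr.1.le
        have : Real.pi ^ 2 * r ^ 2 < ν := by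
          rw [hR, mul_pow]
          have := pow_lt_pow_left₀ hr.2 hr0 two_ne_zero
          gcongr
        exact_mod_cast (hlt _ this).le
      have h3 : R ^ 3 - 3 * √3 * R ^ 2 ≤ (R - √3) ^ 3 := by
        have : (R - √3) ^ 3 = R ^ 3 - 3 * √3 * R ^ 2 + √3 ^ 2 * (3 * R - √3) := by ring
        rw [this, hs]; linarith
      nlinarith
  have h2 : 0 ≤ Real.pi ^ 3 * R ^ 2 := by positivity
  have h3 := mul_le_mul_of_nonneg_left key (sq_nonneg Real.pi)
  nlinarith
end

section
/- For every ε > 0 there exists a constant C > 0 such that for every integer d ≥ 1, the number of triples (x₁,x₂,x₃) ∈ ℤ³ with x₁² + x₂² + x₃² = d is at most C·d^{1/2 + ε}. -/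
/-- `Cov n B`: the Gaussian divisors of `n` are contained in a finset of size at most `B`. -/
def Cov (n : GaussianInt) (B : ℝ) : Prop :=
  ∃ S : Finset GaussianInt, (S.card : ℝ) ≤ B ∧ ∀ z, z ∣ n → z ∈ S

theorem Cov.mono {n : GaussianInt} {B B' : ℝ} (h : Cov n B) (hB : B ≤ B') : Cov n B' := by
  obtain ⟨S, h1, h2⟩ := h
  exact ⟨S, h1.trans hB, h2⟩

theorem Cov.mul {a b : GaussianInt} {A B : ℝ} (ha : Cov a A) (hb : Cov b B) :
    Cov (a * b) (A * B) := by
  classical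
  obtain ⟨S, h1, h2⟩ := ha
  obtain ⟨T, h3, h4⟩ := hb
  refine ⟨Finset.image₂ (· * ·) S T, ?_, ?_⟩
  · have h5 : ((Finset.image₂ (· * ·) S T).card : ℝ) ≤ (S.card : ℝ) * T.card := by
      exact_mod_cast Finset.card_image₂_le (· * ·) S T
    have : (0 : ℝ) ≤ S.card := by positivity
    have : (0 : ℝ) ≤ T.card := by positivity
    exact h5.trans (mul_le_mul h1 h3 (by positivity) (by linarith))
  · intro z hz
    obtain ⟨x, y, hx, hy, rfl⟩ := exists_dvd_and_dvd_of_dvd_mul hz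
    exact Finset.mem_image₂_of_mem (h2 _ hx) (h4 _ hy)

theorem gauss_norm_form (z : GaussianInt) : z.norm = z.re ^ 2 + z.im ^ 2 := by
  rw [Zsqrtd.norm_def]; ring

/-- The finset of candidates for units. -/
noncomputable def unitBox : Finset GaussianInt :=
  (Finset.Icc (-1 : ℤ) 1 ×ˢ Finset.Icc (-1 : ℤ) 1).image (fun p => (⟨p.1, p.2⟩ : GaussianInt))

theorem unitBox_card : unitBox.card ≤ 9 := by
  refine Finset.card_image_le.trans ?_
  decide

theorem mem_unitBox {z : GaussianInt} (h : IsUnit z) : z ∈ unitBox := by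
  have h1 : z.norm = 1 := (Zsqrtd.norm_eq_one_iff' (by norm_num) z).2 h
  rw [gauss_norm_form] at h1
  refine Finset.mem_image.2 ⟨(z.re, z.im), ?_, rfl⟩
  simp only [Finset.mem_product, Finset.mem_Icc]
  refine ⟨⟨?_, ?_⟩, ?_, ?_⟩ <;> nlinarith [sq_nonneg z.re, sq_nonneg z.im]

theorem cov_unit {u : GaussianInt} (h : IsUnit u) : Cov u 9 :=
  ⟨unitBox, by exact_mod_cast unitBox_card, fun _ hz => mem_unitBox (isUnit_of_dvd_unit hz h)⟩

theorem split_prime (p : ℕ) (hp : p.Prime) : Prime (p : GaussianInt) ∨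
    ∃ a b : GaussianInt, Prime a ∧ Prime b ∧ (p : GaussianInt) = a * b := by
  haveI := Fact.mk hp
  by_cases h : Prime (p : GaussianInt)
  · exact Or.inl h
  right
  have h3 : p % 4 ≠ 3 := fun h' => h ((GaussianInt.prime_iff_mod_four_eq_three_of_nat_prime p).2 h')
  obtain ⟨x, y, hxy⟩ := Nat.Prime.sq_add_sq h3
  have key : ∀ z : GaussianInt, z.norm = p → Prime z := by
    intro z hz
    rw [← irreducible_iff_prime]
    refine ⟨fun hu => ?_, fun a b hab => ?_⟩
    · have := (Zsqrtd.norm_eq_one_iff' (by norm_num) z).2 hu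
      rw [hz] at this
      exact hp.one_lt.ne' (by exact_mod_cast this)
    · have h4 : a.norm.natAbs * b.norm.natAbs = p := by
        rw [← Int.natAbs_mul, ← Zsqrtd.norm_mul, ← hab, hz]; simp
      rcases (Nat.prime_mul_iff.1 (h4.symm ▸ hp)) with h5 | h5
      · exact Or.inr (Zsqrtd.norm_eq_one_iff.1 h5.2)
      · exact Or.inl (Zsqrtd.norm_eq_one_iff.1 h5.2)
  have hxy' : (x : ℤ) ^ 2 + (y : ℤ) ^ 2 = p := by exact_mod_cast hxy
  refine ⟨⟨x, y⟩, ⟨x, -y⟩, key _ ?_, key _ ?_, ?_⟩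
  · rw [gauss_norm_form]; exact hxy'
  · rw [gauss_norm_form]; simpa using hxy'
  · ext
    · simp; linarith
    · simp; ring

/-- Powers of a Gaussian prime, not counting units. -/
theorem dvd_two_pow {a b z : GaussianInt} (ha : Prime a) (hb : Prime b) {k : ℕ}
    (hz : z ∣ (a * b) ^ k) : ∃ i ≤ k, ∃ j ≤ k, ∃ u : GaussianInt, IsUnit u ∧ z = u * (a ^ i * b ^ j) := by
  rw [mul_pow] at hz
  obtain ⟨x, y, hx, hy, rfl⟩ := exists_dvd_and_dvd_of_dvd_mul hz
  obtain ⟨i, hi, h1⟩ := (dvd_prime_pow ha k).1 hx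
  obtain ⟨j, hj, h2⟩ := (dvd_prime_pow hb k).1 hy
  obtain ⟨u, hu⟩ := (h1.mul_mul h2).symm
  exact ⟨i, hi, j, hj, u, u.isUnit, by rw [← hu]; ring⟩

theorem cov_prime_pow (p k : ℕ) (hp : p.Prime) :
    Cov ((p ^ k : ℕ) : GaussianInt) (9 * ((k : ℝ) + 1) ^ 2) := by
  classical
  have main : ∀ a b : GaussianInt, (∀ z, z ∣ (p : GaussianInt) ^ k →
      ∃ i ≤ k, ∃ j ≤ k, ∃ u : GaussianInt, IsUnit u ∧ z = u * (a ^ i * b ^ j)) →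
      Cov ((p ^ k : ℕ) : GaussianInt) (9 * ((k : ℝ) + 1) ^ 2) := by
    intro a b h
    refine ⟨(unitBox ×ˢ (Finset.range (k + 1) ×ˢ Finset.range (k + 1))).image
      (fun q => q.1 * (a ^ q.2.1 * b ^ q.2.2)), ?_, ?_⟩
    · have h1 := Finset.card_image_le (s := unitBox ×ˢ (Finset.range (k + 1) ×ˢ Finset.range (k + 1)))
        (f := fun q => q.1 * (a ^ q.2.1 * b ^ q.2.2))
      rw [Finset.card_product, Finset.card_product, Finset.card_range] at h1
      have h2 := h1.trans (Nat.mul_le_mul_right _ unitBox_card)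
      have h3 : (_ : ℝ) ≤ _ := Nat.cast_le.2 h2
      refine h3.trans (le_of_eq ?_)
      push_cast
      ring
    · intro z hz
      push_cast at hz
      obtain ⟨i, hi, j, hj, u, hu, rfl⟩ := h z hz
      refine Finset.mem_image.2 ⟨(u, i, j), ?_, rfl⟩
      simp only [Finset.mem_product, Finset.mem_range]
      exact ⟨mem_unitBox hu, by omega, by omega⟩
  rcases split_prime p hp with h | ⟨a, b, ha, hb, hab⟩
  · refine main p 1 fun z hz => ?_
    obtain ⟨i, hi, h1⟩ := (dvd_prime_pow h k).1 hz
    obtain ⟨u, hu⟩ := h1.symm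
    exact ⟨i, hi, 0, Nat.zero_le _, u, u.isUnit, by rw [← hu]; ring⟩
  · refine main a b fun z hz => ?_
    rw [hab] at hz
    exact dvd_two_pow ha hb hz

theorem exists_K (ε : ℝ) (hε : 0 < ε) :
    ∃ K : ℝ, 1 ≤ K ∧ ∀ k : ℕ, 9 * ((k : ℝ) + 1) ^ 2 ≤ K * ((2 : ℝ) ^ ε) ^ k := by
  have hr : 1 < (2 : ℝ) ^ ε := Real.one_lt_rpow (by norm_num) hε
  set r := (2 : ℝ) ^ ε
  obtain ⟨M, hM⟩ := (tendsto_pow_const_div_const_pow_of_one_lt 2 hr).bddAbove_range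
  refine ⟨max 1 (9 * M * r), le_max_left _ _, fun k => ?_⟩
  have h1 : ((k + 1 : ℕ) : ℝ) ^ 2 / r ^ (k + 1) ≤ M := hM ⟨k + 1, rfl⟩
  rw [div_le_iff₀ (by positivity)] at h1
  push_cast at h1
  calc 9 * ((k : ℝ) + 1) ^ 2 ≤ 9 * (M * r ^ (k + 1)) := by linarith
    _ = (9 * M * r) * r ^ k := by ring
    _ ≤ _ := by gcongr; exact le_max_right _ _

theorem nine_sq_le (k : ℕ) (hk : 0 < k) : 9 * ((k : ℝ) + 1) ^ 2 ≤ 36 ^ k := by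
  induction k, hk using Nat.le_induction with
  | base => norm_num
  | succ n hn ih =>
    have : (1 : ℝ) ≤ n := by exact_mod_cast hn
    rw [pow_succ (36 : ℝ)]
    push_cast
    nlinarith

theorem divisor_bound (ε : ℝ) (hε : 0 < ε) :
    ∃ C : ℝ, 1 ≤ C ∧ ∀ n : ℕ, 1 ≤ n → Cov (n : GaussianInt) (C * (n : ℝ) ^ ε) := by
  obtain ⟨K, hK1, hK⟩ := exists_K ε hε
  obtain ⟨P, hP⟩ := exists_nat_ge ((36 : ℝ) ^ (1 / ε))
  let c : ℕ → ℝ := fun p => if p < P then K else 1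
  have hc1 : ∀ p, 1 ≤ c p := fun p => by simp only [c]; split_ifs <;> simp [hK1]
  have main : ∀ n : ℕ, 1 < n →
      Cov (n : GaussianInt) ((∏ p ∈ n.primeFactors, c p) * (n : ℝ) ^ ε) := by
    intro n
    induction n using Nat.recOnPosPrimePosCoprime with
    | prime_pow p k hp hk =>
      intro _
      refine (cov_prime_pow p k hp).mono ?_
      rw [Nat.primeFactors_prime_pow hk.ne' hp, Finset.prod_singleton]
      have e : ((p ^ k : ℕ) : ℝ) ^ ε = ((p : ℝ) ^ ε) ^ k := by
        push_cast
        rw [← Real.rpow_natCast, ← Real.rpow_mul (by positivity), ← Real.rpow_natCast,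
          ← Real.rpow_mul (by positivity), mul_comm]
      rw [e]
      have hp2 : (2 : ℝ) ≤ p := by exact_mod_cast hp.two_le
      by_cases hpP : p < P
      · simp only [c, if_pos hpP]
        refine (hK k).trans ?_
        gcongr
      · simp only [c, if_neg hpP, one_mul]
        refine (nine_sq_le k hk).trans ?_
        have h36 : (36 : ℝ) ≤ (p : ℝ) ^ ε := by
          have h1 : (36 : ℝ) ^ (1 / ε) ≤ p := hP.trans (by exact_mod_cast not_lt.1 hpP)
          calc (36 : ℝ) = ((36 : ℝ) ^ (1 / ε)) ^ ε := by
                rw [← Real.rpow_mul (by norm_num), one_div_mul_cancel hε.ne', Real.rpow_one]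
            _ ≤ _ := by gcongr
        gcongr
    | zero => intro h; omega
    | one => intro h; omega
    | coprime a b ha hb hab iha ihb =>
      intro _
      have := (iha ha).mul (ihb hb)
      push_cast
      refine this.mono (le_of_eq ?_)
      rw [hab.primeFactors_mul, Finset.prod_union hab.disjoint_primeFactors,
        Real.mul_rpow (by positivity) (by positivity)]
      ring
  have hprod : ∀ n : ℕ, ∏ p ∈ n.primeFactors, c p ≤ K ^ P := by
    intro n
    simp only [c]
    rw [Finset.prod_ite, Finset.prod_const, Finset.prod_const_one, mul_one]
    refine pow_le_pow_right₀ hK1 ?_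
    calc _ ≤ (Finset.range P).card := Finset.card_le_card fun p hp => by
            simp only [Finset.mem_filter] at hp
            exact Finset.mem_range.2 hp.2
      _ = P := by simp
  have hKP : 1 ≤ K ^ P := one_le_pow₀ hK1
  refine ⟨9 * K ^ P, by linarith, fun n hn => ?_⟩
  rcases hn.eq_or_lt with rfl | hn
  · refine (cov_unit (by simp)).mono ?_
    simp only [Nat.cast_one, Real.one_rpow]
    linarith
  · refine (main n hn).mono ?_
    have := hprod n
    gcongr
    linarith

theorem norm_bound (ε : ℝ) (hε : 0 < ε) :
    ∃ C : ℝ, 1 ≤ C ∧ ∀ d : ℕ, 1 ≤ d → ∀ m : ℤ, m ≤ d →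
      ∃ T : Finset GaussianInt, (T.card : ℝ) ≤ C * (d : ℝ) ^ ε ∧
        ∀ z : GaussianInt, z.norm = m → z ∈ T := by
  obtain ⟨C, hC, h⟩ := divisor_bound ε hε
  refine ⟨C, hC, fun d hd m hm => ?_⟩
  have hd1 : (1 : ℝ) ≤ (d : ℝ) ^ ε := Real.one_le_rpow (by exact_mod_cast hd) hε.le
  rcases le_or_gt m 0 with h0 | h0
  · refine ⟨{0}, ?_, fun z hz => ?_⟩
    · simp only [Finset.card_singleton, Nat.cast_one]
      nlinarith
    · rw [gauss_norm_form] at hz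
      have h1 : z.re = 0 := by
        have : z.re ^ 2 ≤ 0 := by nlinarith [sq_nonneg z.im]
        exact pow_eq_zero_iff two_ne_zero |>.1 (le_antisymm this (sq_nonneg _))
      have h2 : z.im = 0 := by
        have : z.im ^ 2 ≤ 0 := by nlinarith [sq_nonneg z.re]
        exact pow_eq_zero_iff two_ne_zero |>.1 (le_antisymm this (sq_nonneg _))
      rw [Finset.mem_singleton]
      ext <;> simp [h1, h2]
  · lift m to ℕ using h0.le
    obtain ⟨T, h1, h2⟩ := h m (by omega)
    have hmd : (m : ℝ) ≤ d := by exact_mod_cast hm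
    refine ⟨T, h1.trans (by gcongr), fun z hz => h2 z ⟨star z, ?_⟩⟩
    rw [← Zsqrtd.norm_eq_mul_conj, hz]
    simp

/-- For every `ε > 0` there is `C > 0` such that for every integer `d ≥ 1`, the number of
integer lattice points on the sphere `x₁² + x₂² + x₃² = d` is at most `C·d^{1/2+ε}`. -/
theorem lattice_points_on_sphere_bound (ε : ℝ) (hε : 0 < ε) :
    ∃ C : ℝ, 0 < C ∧ ∀ d : ℕ, 1 ≤ d →
      (Nat.card {p : ℤ × ℤ × ℤ //
          p.1 ^ 2 + p.2.1 ^ 2 + p.2.2 ^ 2 = (d : ℤ)} : ℝ)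
        ≤ C * (d : ℝ) ^ ((1 : ℝ) / 2 + ε) := by
  classical
  obtain ⟨C, hC, h⟩ := norm_bound ε hε
  refine ⟨3 * C, by linarith, fun d hd => ?_⟩
  have h' : ∀ x : ℤ, ∃ T : Finset GaussianInt, (T.card : ℝ) ≤ C * (d : ℝ) ^ ε ∧
        ∀ z : GaussianInt, z.norm = d - x ^ 2 → z ∈ T :=
    fun x => h d hd _ (by nlinarith [sq_nonneg x])
  choose T hT1 hT2 using h'
  let s : ℤ := (Nat.sqrt d : ℤ)
  let F : Finset (ℤ × ℤ × ℤ) := (Finset.Icc (-s) s).biUnion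
    (fun x => (T x).image fun z => (x, z.re, z.im))
  have hsub : {p : ℤ × ℤ × ℤ | p.1 ^ 2 + p.2.1 ^ 2 + p.2.2 ^ 2 = (d : ℤ)} ⊆ (F : Set (ℤ × ℤ × ℤ)) := by
    rintro ⟨x, y, w⟩ hp
    simp only [Set.mem_ofPred_eq] at hp
    refine Finset.mem_coe.2 (Finset.mem_biUnion.2 ⟨x, ?_, ?_⟩)
    · have h1 : x.natAbs ≤ Nat.sqrt d := by
        rw [Nat.le_sqrt']
        zify
        rw [sq_abs]
        nlinarith [sq_nonneg y, sq_nonneg w]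
      rw [Finset.mem_Icc]
      simp only [s]
      omega
    · refine Finset.mem_image.2 ⟨⟨y, w⟩, hT2 x _ ?_, rfl⟩
      rw [gauss_norm_form]
      linarith
  have h1 : Nat.card {p : ℤ × ℤ × ℤ // p.1 ^ 2 + p.2.1 ^ 2 + p.2.2 ^ 2 = (d : ℤ)} ≤ F.card := by
    have := Set.ncard_le_ncard hsub F.finite_toSet
    rwa [Set.ncard_coe_finset] at this
  have h2 : F.card ≤ ∑ x ∈ Finset.Icc (-s) s, (T x).card :=
    Finset.card_biUnion_le.trans (Finset.sum_le_sum fun x _ => Finset.card_image_le)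
  have h3 : (∑ x ∈ Finset.Icc (-s) s, ((T x).card : ℝ)) ≤ (2 * (Nat.sqrt d : ℝ) + 1) * (C * (d : ℝ) ^ ε) := by
    refine (Finset.sum_le_card_nsmul _ _ _ fun x _ => hT1 x).trans (le_of_eq ?_)
    rw [nsmul_eq_mul, Int.card_Icc]
    congr 1
    have : (s + 1 - -s).toNat = 2 * Nat.sqrt d + 1 := by simp only [s]; omega
    rw [this]
    push_cast
    ring
  have h4 : (Nat.sqrt d : ℝ) ≤ (d : ℝ) ^ ((1 : ℝ) / 2) := by
    rw [← Real.sqrt_eq_rpow]; exact Real.nat_sqrt_le_real_sqrt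
  have hd' : (1 : ℝ) ≤ d := by exact_mod_cast hd
  have h5 : (1 : ℝ) ≤ (d : ℝ) ^ ((1 : ℝ) / 2) := Real.one_le_rpow hd' (by norm_num)
  calc (Nat.card {p : ℤ × ℤ × ℤ // p.1 ^ 2 + p.2.1 ^ 2 + p.2.2 ^ 2 = (d : ℤ)} : ℝ)
      ≤ ∑ x ∈ Finset.Icc (-s) s, ((T x).card : ℝ) := by exact_mod_cast h1.trans h2
    _ ≤ _ := h3
    _ ≤ (3 * (d : ℝ) ^ ((1 : ℝ) / 2)) * (C * (d : ℝ) ^ ε) := by gcongr; linarith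
    _ = _ := by rw [Real.rpow_add (by linarith)]; ring
end
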